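/- arXiv:2603.05098 — 3 statements merged into one kernel-verified Lean document; each statement's English description precedes it below -/
import Mathlib

section
/- Assume α ∈ ℓ^{1,1}(ℤ). For every λ ∈ ℂ with Im λ > 0, the sequence of vectors (P_j(λ)⁻¹ (1,0)ᵀ)_{j≥1} in ℂ² converges as j → +∞, and the sequence (P_j(λ)⁻¹ (0,1)ᵀ)_{j≤−1} converges as j → −∞. Moreover the limit functions v_+ : λ ↦ lim_{j→+∞} P_j(λ)⁻¹(1,0)ᵀ and v_− : λ ↦ lim_{j→−∞} P_j(λ)⁻¹(0,1)ᵀ are holomorphic (componentwise) on the upper half-plane ℂ⁺ := {λ ∈ ℂ : Im λ > 0}. -/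
open Complex Filter Matrix

open Complex Filter Matrix

/-- The nilpotent matrix `N_j(λ)` from the paper. -/
noncomputable def Nmat (j : ℤ) (lam : ℂ) : Matrix (Fin 2) (Fin 2) ℂ :=
  if lam = 0 then
    ((j.sign : ℤ) : ℂ) • !![-(j : ℂ), -((j : ℂ)) ^ 2; 1, (j : ℂ)]
  else
    (((j.sign : ℤ) : ℂ) / (2 * Complex.I * lam)) •
      !![1, Complex.exp (-(2 * Complex.I * lam * (j : ℂ)));
         -Complex.exp (2 * Complex.I * lam * (j : ℂ)), -1]

/-- `M_j(λ) = I₂ + α_j N_j(λ)`. -/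
noncomputable def Mmat (α : ℤ → ℝ) (j : ℤ) (lam : ℂ) : Matrix (Fin 2) (Fin 2) ℂ :=
  1 + (α j : ℂ) • Nmat j lam

/-- `Ppos α lam n = M_n(λ) ⋯ M_1(λ)`, i.e. `P_j(λ)` for `j = n ≥ 1` (with `Ppos 0 = I₂`). -/
noncomputable def Ppos (α : ℤ → ℝ) (lam : ℂ) : ℕ → Matrix (Fin 2) (Fin 2) ℂ
  | 0 => 1
  | n + 1 => Mmat α ((n : ℤ) + 1) lam * Ppos α lam n

/-- `Pneg α lam n = M_{-n}(λ) ⋯ M_{-1}(λ)`, i.e. `P_j(λ)` for `j = -n ≤ -1` (with `Pneg 0 = I₂`). -/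
noncomputable def Pneg (α : ℤ → ℝ) (lam : ℂ) : ℕ → Matrix (Fin 2) (Fin 2) ℂ
  | 0 => 1
  | n + 1 => Mmat α (-((n : ℤ) + 1)) lam * Pneg α lam n


/-- The recursion satisfied by the entries `(x, exp (2iλn) y)` of a row of the inverse transfer
matrices, where `x` is the entry in the column whose limit is taken. -/
noncomputable def rowRec (β : ℕ → ℝ) (x y lam : ℂ) : ℕ → ℂ × ℂ
  | 0 => (x, y)
  | n + 1 =>
    let p := rowRec β x y lam n
    let d := (β n : ℂ) / (2 * Complex.I * lam) * (p.1 - Complex.exp (2 * Complex.I * lam) * p.2)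
    (p.1 - d, Complex.exp (2 * Complex.I * lam) * p.2 - d)

lemma norm_exp_two_I_mul_le_one {lam : ℂ} (h : 0 < lam.im) :
    ‖Complex.exp (2 * Complex.I * lam)‖ ≤ 1 := by
  rw [Complex.norm_exp, Real.exp_le_one_iff]
  simp
  exact h.le

lemma norm_div_two_I_mul_le {δ : ℝ} (hδ : 0 < δ) {lam : ℂ} (h : δ < lam.im) (b : ℝ) :
    ‖(b : ℂ) / (2 * Complex.I * lam)‖ ≤ |b| / (2 * δ) := by
  have h1 : δ ≤ ‖lam‖ := h.le.trans ((le_abs_self _).trans (Complex.abs_im_le_norm lam))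
  rw [norm_div, Complex.norm_real, Real.norm_eq_abs, norm_mul, norm_mul, Complex.norm_I]
  simp only [Complex.norm_ofNat, mul_one]
  gcongr

lemma norm_rowRec_increment_le {δ : ℝ} (hδ : 0 < δ) {lam : ℂ} (h : δ < lam.im) (b : ℝ) {p : ℂ × ℂ} :
    ‖(b : ℂ) / (2 * Complex.I * lam) * (p.1 - Complex.exp (2 * Complex.I * lam) * p.2)‖ ≤
      |b| / δ * ‖p‖ := by
  have h1 := norm_exp_two_I_mul_le_one (hδ.trans h)
  have h2 : ‖p.1 - Complex.exp (2 * Complex.I * lam) * p.2‖ ≤ 2 * ‖p‖ := by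
    refine (norm_sub_le _ _).trans ?_
    rw [norm_mul]
    have := norm_fst_le p
    have := norm_snd_le p
    nlinarith [norm_nonneg p.2]
  rw [norm_mul]
  calc _ ≤ |b| / (2 * δ) * (2 * ‖p‖) := by
        gcongr
        exact norm_div_two_I_mul_le hδ h b
    _ = _ := by field_simp

lemma norm_rowRec_le (β : ℕ → ℝ) (x y : ℂ) (hβ : Summable fun n => |β n|) {δ : ℝ} (hδ : 0 < δ)
    {lam : ℂ} (h : δ < lam.im) (n : ℕ) :
    ‖rowRec β x y lam n‖ ≤ Real.exp ((∑' k, |β k|) / δ) * ‖(x, y)‖ := by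
  have key : ‖rowRec β x y lam n‖ ≤
      Real.exp ((∑ k ∈ Finset.range n, |β k|) / δ) * ‖(x, y)‖ := by
    induction n with
    | zero => simp [rowRec]
    | succ n ih =>
      set p := rowRec β x y lam n with hp
      have h1 := norm_exp_two_I_mul_le_one (hδ.trans h)
      have h2 := norm_rowRec_increment_le hδ h (β n) (p := p)
      have h3 : ‖rowRec β x y lam (n + 1)‖ ≤ (|β n| / δ + 1) * ‖p‖ := by
        rw [rowRec, ← hp, norm_prod_le_iff]
        constructor
        · refine (norm_sub_le _ _).trans ?_
          linarith [norm_fst_le p]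
        · refine (norm_sub_le _ _).trans ?_
          rw [norm_mul]
          nlinarith [norm_snd_le p, norm_nonneg p.2]
      rw [Finset.sum_range_succ, add_div, Real.exp_add]
      calc _ ≤ _ := h3
        _ ≤ Real.exp (|β n| / δ) *
            (Real.exp ((∑ k ∈ Finset.range n, |β k|) / δ) * ‖(x, y)‖) := by
          gcongr
          exact Real.add_one_le_exp _
        _ = _ := by ring
  refine key.trans ?_
  gcongr
  exact hβ.sum_le_tsum _ fun _ _ => abs_nonneg _

lemma differentiableOn_rowRec (β : ℕ → ℝ) (x y : ℂ) (n : ℕ) :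
    DifferentiableOn ℂ (fun lam => rowRec β x y lam n) {z : ℂ | 0 < z.im} := by
  induction n with
  | zero => exact differentiableOn_const _
  | succ n ih =>
    have hne : ∀ z ∈ {z : ℂ | 0 < z.im}, 2 * Complex.I * z ≠ 0 := by
      rintro z hz
      have : z ≠ 0 := by rintro rfl; simp at hz
      simp [this]
    have h1 := ih.fst
    have h2 := ih.snd
    simp only [rowRec]
    have hd : DifferentiableOn ℂ (fun lam => (β n : ℂ) / (2 * Complex.I * lam))
        {z : ℂ | 0 < z.im} :=
      (differentiableOn_const _).div (by fun_prop) hne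
    have he : DifferentiableOn ℂ (fun lam => Complex.exp (2 * Complex.I * lam))
        {z : ℂ | 0 < z.im} := by fun_prop
    exact (h1.sub (hd.mul (h1.sub (he.mul h2)))).prodMk
      ((he.mul h2).sub (hd.mul (h1.sub (he.mul h2))))

lemma exists_holomorphic_limit_rowRec (β : ℕ → ℝ) (x y : ℂ) (hβ : Summable fun n => |β n|) :
    ∃ v : ℂ → ℂ,
      (∀ lam : ℂ, 0 < lam.im →
        Tendsto (fun n => (rowRec β x y lam n).1) atTop (nhds (v lam))) ∧
      DifferentiableOn ℂ v {z : ℂ | 0 < z.im} := by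
  set f : ℕ → ℂ → ℂ := fun n lam => (rowRec β x y lam (n + 1)).1 - (rowRec β x y lam n).1 with hf
  set u : ℝ → ℕ → ℝ := fun δ n =>
    |β n| / δ * (Real.exp ((∑' k, |β k|) / δ) * ‖(x, y)‖) with hu
  have hus (δ : ℝ) : Summable (u δ) := (hβ.div_const δ).mul_right _
  have hfu {δ : ℝ} (hδ : 0 < δ) (n : ℕ) (lam : ℂ) (h : δ < lam.im) : ‖f n lam‖ ≤ u δ n := by
    simp only [hf, hu, rowRec, sub_sub_cancel_left, norm_neg]
    refine (norm_rowRec_increment_le hδ h (β n)).trans ?_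
    gcongr
    exact norm_rowRec_le β x y hβ hδ h n
  refine ⟨fun lam => x + ∑' n, f n lam, fun lam h => ?_, fun lam h => ?_⟩
  · have hs : Summable fun n => f n lam :=
      Summable.of_norm_bounded (hus (lam.im / 2))
        fun n => hfu (half_pos h) n lam (half_lt_self h)
    refine (hs.hasSum.tendsto_sum_nat.const_add x).congr fun n => ?_
    simp only [hf]
    rw [Finset.sum_range_sub fun n => (rowRec β x y lam n).1]
    simp [rowRec]
  · have hlam : 0 < lam.im := h
    have ho : IsOpen {z : ℂ | lam.im / 2 < z.im} :=
      isOpen_lt continuous_const Complex.continuous_im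
    have hd : DifferentiableOn ℂ (fun z => ∑' n, f n z) {z : ℂ | lam.im / 2 < z.im} := by
      refine Complex.differentiableOn_tsum_of_summable_norm (hus (lam.im / 2)) (fun n => ?_) ho
        fun n z hz => hfu (half_pos hlam) n z hz
      refine DifferentiableOn.mono ?_ fun z (hz : lam.im / 2 < z.im) =>
        show 0 < z.im from (half_pos hlam).trans hz
      exact (differentiableOn_rowRec β x y (n + 1)).fst.sub (differentiableOn_rowRec β x y n).fst
    exact ((hd.differentiableAt (ho.mem_nhds (half_lt_self hlam))).const_add x).differentiableWithinAt

lemma Nmat_mul_self (j : ℤ) (lam : ℂ) : Nmat j lam * Nmat j lam = 0 := by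
  unfold Nmat
  split_ifs
  · ext a b
    fin_cases a <;> fin_cases b <;> simp [Matrix.mul_apply, Fin.sum_univ_two] <;> ring
  · rw [Matrix.smul_mul, Matrix.mul_smul]
    ext a b
    fin_cases a <;> fin_cases b <;> simp [Complex.exp_neg]

lemma Mmat_inv (α : ℤ → ℝ) (j : ℤ) (lam : ℂ) :
    (Mmat α j lam)⁻¹ = 1 - (α j : ℂ) • Nmat j lam := by
  apply Matrix.inv_eq_right_inv
  simp [Mmat, add_mul, mul_sub, Nmat_mul_self]

lemma Ppos_inv_row (α : ℤ → ℝ) {lam : ℂ} (hlam : lam ≠ 0) (i : Fin 2) (n : ℕ) :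
    ((Ppos α lam n)⁻¹ i 0, Complex.exp (2 * Complex.I * lam * n) * (Ppos α lam n)⁻¹ i 1) =
      rowRec (fun n => α ((n : ℤ) + 1)) ((1 : Matrix (Fin 2) (Fin 2) ℂ) i 0)
        ((1 : Matrix (Fin 2) (Fin 2) ℂ) i 1) lam n := by
  induction n with
  | zero => simp [Ppos, rowRec]
  | succ n ih =>
    have hs : ((n : ℤ) + 1).sign = 1 := Int.sign_eq_one_of_pos (by positivity)
    rw [rowRec, ← ih, Ppos, Matrix.mul_inv_rev, Mmat_inv]
    have h1 : Complex.exp (2 * Complex.I * lam * ((n : ℂ) + 1)) =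
        Complex.exp (2 * Complex.I * lam) * Complex.exp (2 * Complex.I * lam * n) := by
      rw [← Complex.exp_add]; ring_nf
    have hq := Complex.exp_ne_zero (2 * Complex.I * lam)
    have hE := Complex.exp_ne_zero (2 * Complex.I * lam * n)
    ext <;> simp [Nmat, hlam, hs, Matrix.mul_apply, Fin.sum_univ_two, Complex.exp_neg, h1] <;>
      field_simp <;> ring_nf <;> simp only [Complex.I_sq] <;> ring

lemma Pneg_inv_row (α : ℤ → ℝ) {lam : ℂ} (hlam : lam ≠ 0) (i : Fin 2) (n : ℕ) :
    ((Pneg α lam n)⁻¹ i 1, Complex.exp (2 * Complex.I * lam * n) * (Pneg α lam n)⁻¹ i 0) =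
      rowRec (fun n => α (-((n : ℤ) + 1))) ((1 : Matrix (Fin 2) (Fin 2) ℂ) i 1)
        ((1 : Matrix (Fin 2) (Fin 2) ℂ) i 0) lam n := by
  induction n with
  | zero => simp [Pneg, rowRec]
  | succ n ih =>
    have hs : ((n : ℤ) + 1).sign = 1 := Int.sign_eq_one_of_pos (by positivity)
    rw [rowRec, ← ih, Pneg, Matrix.mul_inv_rev, Mmat_inv]
    have h1 : Complex.exp (2 * Complex.I * lam * ((n : ℂ) + 1)) =
        Complex.exp (2 * Complex.I * lam) * Complex.exp (2 * Complex.I * lam * n) := by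
      rw [← Complex.exp_add]; ring_nf
    have hq := Complex.exp_ne_zero (2 * Complex.I * lam)
    have hE := Complex.exp_ne_zero (2 * Complex.I * lam * n)
    ext <;> simp [Nmat, hlam, hs, Matrix.mul_apply, Fin.sum_univ_two, Complex.exp_neg, h1,
      -neg_add_rev] <;> field_simp <;> ring

lemma summable_abs_of_summable_abs_mul {α : ℤ → ℝ}
    (hα : Summable fun j : ℤ => |(j : ℝ)| * |α j|) {g : ℕ → ℤ} (hg : Function.Injective g)
    (h0 : ∀ n, g n ≠ 0) : Summable fun n => |α (g n)| := by
  refine Summable.of_nonneg_of_le (fun _ => abs_nonneg _) (fun n => ?_) (hα.comp_injective hg)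
  have : (1 : ℝ) ≤ |(g n : ℝ)| := by exact_mod_cast Int.one_le_abs (h0 n)
  exact le_mul_of_one_le_left (abs_nonneg _) this

/-- If `α ∈ ℓ^{1,1}(ℤ)`, then for every `λ` in the upper half-plane the vectors
`P_j(λ)⁻¹ (1,0)ᵀ` converge as `j → +∞` and `P_j(λ)⁻¹ (0,1)ᵀ` converge as `j → -∞`,
and the limit functions are holomorphic (componentwise) on `ℂ⁺`. -/
theorem statement1 (α : ℤ → ℝ) (hα : Summable fun j : ℤ => |(j : ℝ)| * |α j|) :
    ∃ vPlus vMinus : ℂ → Fin 2 → ℂ,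
      (∀ lam : ℂ, 0 < lam.im →
        Tendsto (fun n : ℕ => (Ppos α lam n)⁻¹ *ᵥ ![1, 0]) atTop (nhds (vPlus lam)) ∧
        Tendsto (fun n : ℕ => (Pneg α lam n)⁻¹ *ᵥ ![0, 1]) atTop (nhds (vMinus lam))) ∧
      (∀ i : Fin 2,
        DifferentiableOn ℂ (fun lam : ℂ => vPlus lam i) {z : ℂ | 0 < z.im} ∧
        DifferentiableOn ℂ (fun lam : ℂ => vMinus lam i) {z : ℂ | 0 < z.im}) := by
  have hp : Summable fun n : ℕ => |α ((n : ℤ) + 1)| :=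
    summable_abs_of_summable_abs_mul hα (g := fun n : ℕ => (n : ℤ) + 1)
      (fun a b h => by simpa using h) fun n => by lia
  have hn : Summable fun n : ℕ => |α (-((n : ℤ) + 1))| :=
    summable_abs_of_summable_abs_mul hα (g := fun n : ℕ => -((n : ℤ) + 1))
      (fun a b h => by simpa using h) fun n => by lia
  choose vp hvp hdp using fun i : Fin 2 => exists_holomorphic_limit_rowRec _
    ((1 : Matrix (Fin 2) (Fin 2) ℂ) i 0) ((1 : Matrix (Fin 2) (Fin 2) ℂ) i 1) hp
  choose vn hvn hdn using fun i : Fin 2 => exists_holomorphic_limit_rowRec _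
    ((1 : Matrix (Fin 2) (Fin 2) ℂ) i 1) ((1 : Matrix (Fin 2) (Fin 2) ℂ) i 0) hn
  refine ⟨fun lam i => vp i lam, fun lam i => vn i lam, fun lam h => ?_,
    fun i => ⟨hdp i, hdn i⟩⟩
  have hlam : lam ≠ 0 := by rintro rfl; simp at h
  constructor
  · refine tendsto_pi_nhds.2 fun i => (hvp i lam h).congr fun n => ?_
    rw [← Ppos_inv_row α hlam i n]
    simp [Matrix.mulVec, dotProduct, Fin.sum_univ_two]
  · refine tendsto_pi_nhds.2 fun i => (hvn i lam h).congr fun n => ?_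
    rw [← Pneg_inv_row α hlam i n]
    simp [Matrix.mulVec, dotProduct, Fin.sum_univ_two]
end

section
/- Assume α ∈ ℓ^{1,1}(ℤ). Then there exist sequences A⁺, B⁺ : ℤ → ℂ such that for every j ∈ ℤ: A⁺_j + B⁺_j·j = A⁺_{j−1} + B⁺_{j−1}·j and B⁺_j − B⁺_{j−1} = α_j (A⁺_j + B⁺_j·j), and such that (A⁺_j, B⁺_j) → (1, 0) as j → +∞. Likewise, there exist sequences A⁻, B⁻ : ℤ → ℂ satisfying the same relations for every j ∈ ℤ with (A⁻_j, B⁻_j) → (1, 0) as j → −∞. (The associated piecewise functions f_±(0,x) = A^±_j + B^±_j x for x ∈ [j, j+1) are the zero-energy Jost solutions: continuous, affine on each interval (j, j+1), with derivative jumping by α_j f(j) at each integer j, and f_+(0,x) → 1 as x → +∞, f_−(0,x) → 1 as x → −∞.) -/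
open Complex Filter

/-- The discrete Volterra equation `f j = 1 + ∑_{k > j} (k - j) a k f k` has a bounded solution
when `∑ k ‖a k‖ < 1`. The truncated subtraction `k - j` restricts the sum to `k > j`. -/
lemma exists_bounded_volterra_solution (a : ℕ → ℂ) (ha : Summable fun k : ℕ => (k : ℝ) * ‖a k‖)
    (ha1 : ∑' k : ℕ, (k : ℝ) * ‖a k‖ < 1) :
    ∃ (f : ℕ → ℂ) (C : ℝ), (∀ j, ‖f j‖ ≤ C) ∧
      ∀ j, f j = 1 + ∑' k : ℕ, ((k - j : ℕ) : ℂ) * (a k * f k) := by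
  set K : ℝ := ∑' k : ℕ, (k : ℝ) * ‖a k‖ with hK
  have hK0 : 0 ≤ K := tsum_nonneg fun k => by positivity
  have hbound : ∀ (g : BoundedContinuousFunction ℕ ℂ) (j k : ℕ),
      ‖((k - j : ℕ) : ℂ) * (a k * g k)‖ ≤ ((k : ℝ) * ‖a k‖) * ‖g‖ := by
    intro g j k
    rw [norm_mul, norm_mul, Complex.norm_natCast, ← mul_assoc]
    have h1 : ((k - j : ℕ) : ℝ) ≤ k := by exact_mod_cast Nat.sub_le k j
    have h2 := g.norm_coe_le_norm k
    gcongr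
  have hsum : ∀ (g : BoundedContinuousFunction ℕ ℂ) (j : ℕ),
      Summable fun k : ℕ => ((k - j : ℕ) : ℂ) * (a k * g k) := fun g j =>
    Summable.of_norm_bounded (ha.mul_right ‖g‖) (hbound g j)
  have hnorm : ∀ (g : BoundedContinuousFunction ℕ ℂ) (j : ℕ),
      ‖∑' k : ℕ, ((k - j : ℕ) : ℂ) * (a k * g k)‖ ≤ K * ‖g‖ := fun g j =>
    tsum_of_norm_bounded (ha.hasSum.mul_right ‖g‖) (hbound g j)
  let T : BoundedContinuousFunction ℕ ℂ → BoundedContinuousFunction ℕ ℂ := fun g =>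
    BoundedContinuousFunction.ofNormedAddCommGroupDiscrete
      (fun j => 1 + ∑' k : ℕ, ((k - j : ℕ) : ℂ) * (a k * g k)) (1 + K * ‖g‖)
      (fun j => (norm_add_le _ _).trans (by simpa using hnorm g j))
  have hTapp : ∀ g j, T g j = 1 + ∑' k : ℕ, ((k - j : ℕ) : ℂ) * (a k * g k) := fun _ _ => rfl
  have hT : ContractingWith ⟨K, hK0⟩ T := by
    refine ⟨by exact_mod_cast ha1, LipschitzWith.of_dist_le_mul fun g h => ?_⟩
    rw [BoundedContinuousFunction.dist_le (by positivity)]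
    intro j
    have hsub : T g j - T h j = ∑' k : ℕ, ((k - j : ℕ) : ℂ) * (a k * (g - h) k) := by
      rw [hTapp, hTapp, add_sub_add_left_eq_sub, ← (hsum g j).tsum_sub (hsum h j)]
      refine tsum_congr fun k => ?_
      simp only [BoundedContinuousFunction.coe_sub, Pi.sub_apply]
      ring
    rw [dist_eq_norm, dist_eq_norm, hsub]
    exact hnorm (g - h) j
  obtain ⟨g, hg⟩ : ∃ g, T g = g := ⟨_, hT.fixedPoint_isFixedPt⟩
  exact ⟨g, ‖g‖, g.norm_coe_le_norm, fun j => by rw [← hTapp, hg]⟩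

/-- Jost coefficients on `ℕ` for a potential with `∑ k ‖a k‖ < 1`. -/
lemma exists_jost_nat (a : ℕ → ℂ) (ha : Summable fun k : ℕ => (k : ℝ) * ‖a k‖)
    (ha1 : ∑' k : ℕ, (k : ℝ) * ‖a k‖ < 1) :
    ∃ A B : ℕ → ℂ,
      (∀ j : ℕ, A j = A (j + 1) + (j + 1) * (a (j + 1) * (A (j + 1) + B (j + 1) * (j + 1))) ∧
        B j = B (j + 1) - a (j + 1) * (A (j + 1) + B (j + 1) * (j + 1))) ∧
      Tendsto A atTop (nhds 1) ∧ Tendsto B atTop (nhds 0) := by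
  obtain ⟨f, C, hC, hf⟩ := exists_bounded_volterra_solution a ha ha1
  have h1 : Summable fun k : ℕ => (k : ℂ) * (a k * f k) := by
    refine Summable.of_norm_bounded (ha.mul_right C) fun k => ?_
    rw [norm_mul, norm_mul, Complex.norm_natCast, ← mul_assoc]
    exact mul_le_mul_of_nonneg_left (hC k) (by positivity)
  have h0 : Summable fun k : ℕ => a k * f k := by
    rw [← summable_nat_add_iff 1]
    refine Summable.of_norm_bounded ((summable_nat_add_iff 1).2 h1.norm) fun k => ?_
    rw [norm_mul (((k + 1 : ℕ) : ℂ)), Complex.norm_natCast]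
    exact le_mul_of_one_le_left (norm_nonneg _) (by push_cast; linarith [k.cast_nonneg (α := ℝ)])
  have hfAB : ∀ j : ℕ, (1 + ∑' i : ℕ, ((i + (j + 1) : ℕ) : ℂ) * (a (i + (j + 1)) * f (i + (j + 1))))
      + (-∑' i : ℕ, a (i + (j + 1)) * f (i + (j + 1))) * j = f j := by
    intro j
    have s1 := (summable_nat_add_iff (j + 1)).2 h1
    have s0 := (summable_nat_add_iff (j + 1)).2 h0
    have hs : Summable fun k : ℕ => ((k - j : ℕ) : ℂ) * (a k * f k) := by
      refine Summable.of_norm_bounded h1.norm fun k => ?_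
      rw [norm_mul, norm_mul (k : ℂ), Complex.norm_natCast, Complex.norm_natCast]
      have : ((k - j : ℕ) : ℝ) ≤ k := by exact_mod_cast Nat.sub_le k j
      gcongr
    rw [hf j, ← hs.sum_add_tsum_nat_add (j + 1), Finset.sum_eq_zero, zero_add, neg_mul,
      ← tsum_mul_right, add_assoc, ← sub_eq_add_neg, ← s1.tsum_sub (s0.mul_right _)]
    · congr 1
      refine tsum_congr fun i => ?_
      rw [show i + (j + 1) - j = i + 1 by omega]
      push_cast
      ring
    · intro k hk
      rw [Nat.sub_eq_zero_of_le (by simpa [Nat.lt_succ_iff] using hk)]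
      simp
  have hstep : ∀ (g : ℕ → ℂ), Summable g → ∀ j : ℕ,
      ∑' i : ℕ, g (i + (j + 1)) = g (j + 1) + ∑' i : ℕ, g (i + (j + 1 + 1)) := by
    intro g hg j
    rw [((summable_nat_add_iff (j + 1)).2 hg).tsum_eq_zero_add, zero_add]
    congr 1
    exact tsum_congr fun i => by congr 1; omega
  refine ⟨fun j => 1 + ∑' i : ℕ, ((i + (j + 1) : ℕ) : ℂ) * (a (i + (j + 1)) * f (i + (j + 1))),
    fun j => -∑' i : ℕ, a (i + (j + 1)) * f (i + (j + 1)), fun j => ?_, ?_, ?_⟩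
  · have h := hfAB (j + 1)
    rw [Nat.cast_add_one] at h
    constructor
    · beta_reduce
      rw [h, hstep (fun k => (k : ℂ) * (a k * f k)) h1 j]
      push_cast
      ring
    · beta_reduce
      rw [h, hstep (fun k => a k * f k) h0 j]
      ring
  · have h := ((tendsto_sum_nat_add fun k : ℕ => (k : ℂ) * (a k * f k)).comp
      (tendsto_add_atTop_nat 1)).const_add 1
    simpa using h
  · have h := ((tendsto_sum_nat_add fun k : ℕ => a k * f k).comp (tendsto_add_atTop_nat 1)).neg
    simpa using h

/-- A sequence on `ℕ` can be continued from any index `N` to all of `ℤ` by a backward recursion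
that it satisfies beyond `N`. -/
lemma exists_backward_extension {X : Type*} (S : ℤ → X → X) (v : ℕ → X) (N : ℕ)
    (hv : ∀ j : ℕ, N ≤ j → v j = S (j + 1) (v (j + 1))) :
    ∃ u : ℤ → X, (∀ j : ℤ, u (j - 1) = S j (u j)) ∧ ∀ j : ℕ, N ≤ j → u j = v j := by
  let w : ℕ → X := fun n => Nat.rec (v N) (fun i x => S (N - i) x) n
  refine ⟨fun j => if (N : ℤ) ≤ j then v j.toNat else w (N - j).toNat, fun j => ?_, fun j hj => ?_⟩
  · rcases lt_trichotomy j N with h | rfl | h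
    · obtain ⟨i, hi⟩ : ∃ i : ℕ, (N : ℤ) - j = i := ⟨(N - j).toNat, by omega⟩
      beta_reduce
      rw [if_neg (by omega), if_neg (by omega), show ((N : ℤ) - (j - 1)).toNat = i + 1 by omega, hi,
        Int.toNat_natCast]
      change S (N - i) (w i) = _
      rw [show (N : ℤ) - i = j by omega]
    · beta_reduce
      rw [if_neg (by omega), if_pos le_rfl, show ((N : ℤ) - (N - 1)).toNat = 0 + 1 by omega]
      change S (N - (0 : ℕ)) (v N) = _
      simp
    · obtain ⟨i, rfl⟩ : ∃ i : ℕ, j = i + 1 := ⟨(j - 1).toNat, by omega⟩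
      beta_reduce
      rw [if_pos (by omega), if_pos (by omega), show ((i : ℤ) + 1 - 1).toNat = i by omega,
        show ((i : ℤ) + 1).toNat = i + 1 by omega]
      exact hv i (by omega)
  · simp [hj]

/-- Jost coefficients at `+∞`. -/
lemma exists_jost_atTop (α : ℤ → ℝ) (hα : Summable fun j : ℤ => |(j : ℝ)| * |α j|) :
    ∃ A B : ℤ → ℂ,
      (∀ j : ℤ,
        A j + B j * (j : ℂ) = A (j - 1) + B (j - 1) * (j : ℂ) ∧
        B j - B (j - 1) = (α j : ℂ) * (A j + B j * (j : ℂ))) ∧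
      Tendsto A atTop (nhds 1) ∧ Tendsto B atTop (nhds 0) := by
  have hnat : Summable fun k : ℕ => (k : ℝ) * |α k| := by
    simpa [Function.comp_def] using hα.comp_injective (Nat.cast_injective (R := ℤ))
  obtain ⟨N, hN⟩ := ((tendsto_sum_nat_add fun k : ℕ => (k : ℝ) * |α k|).eventually
    (gt_mem_nhds one_pos)).exists
  let a : ℕ → ℂ := fun k => if N ≤ k then (α k : ℂ) else 0
  have ha : Summable fun k : ℕ => (k : ℝ) * ‖a k‖ := by
    refine Summable.of_nonneg_of_le (fun k => by positivity) (fun k => ?_) hnat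
    by_cases h : N ≤ k
    · simp [a, h]
    · simp only [a, h, if_false, norm_zero, mul_zero]
      positivity
  have ha1 : ∑' k : ℕ, (k : ℝ) * ‖a k‖ < 1 := by
    rw [← ha.sum_add_tsum_nat_add N, Finset.sum_eq_zero, zero_add]
    · simpa [a] using hN
    · intro k hk
      simp [a, Finset.mem_range.1 hk]
  obtain ⟨A, B, hAB, hA, hB⟩ := exists_jost_nat a ha ha1
  obtain ⟨u, hu, huv⟩ := exists_backward_extension
    (fun j x => ((x.1 + j * (α j * (x.1 + x.2 * j)), x.2 - α j * (x.1 + x.2 * j)) : ℂ × ℂ))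
    (fun j => (A j, B j)) N (by
      intro j hj
      have h := hAB j
      simp only [a, if_pos (show N ≤ j + 1 by omega)] at h
      push_cast at h ⊢
      exact Prod.ext h.1 h.2)
  have hto : Tendsto Int.toNat atTop atTop := tendsto_atTop.2 fun b => by
    filter_upwards [eventually_ge_atTop (b : ℤ)] with j hj
    omega
  have hlim : Tendsto u atTop (nhds ((1 : ℂ), (0 : ℂ))) := by
    refine ((hA.prodMk_nhds hB).comp hto).congr' ?_
    filter_upwards [eventually_ge_atTop (N : ℤ)] with j hj
    have h := huv j.toNat (by omega)
    rw [Int.toNat_of_nonneg (by omega)] at h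
    exact h.symm
  refine ⟨fun j => (u j).1, fun j => (u j).2, fun j => ?_, hlim.fst_nhds, hlim.snd_nhds⟩
  beta_reduce
  rw [hu j]
  constructor <;> ring

/-- Zero-energy Jost coefficients: if `α ∈ ℓ^{1,1}(ℤ)`, there are sequences
`A⁺, B⁺ : ℤ → ℂ` with `A⁺_j + B⁺_j j = A⁺_{j−1} + B⁺_{j−1} j` and
`B⁺_j − B⁺_{j−1} = α_j (A⁺_j + B⁺_j j)` for all `j`, and `(A⁺_j, B⁺_j) → (1,0)` as
`j → +∞`; likewise sequences `A⁻, B⁻` with the same relations and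
`(A⁻_j, B⁻_j) → (1,0)` as `j → −∞`. -/
theorem statement6 (α : ℤ → ℝ) (hα : Summable fun j : ℤ => |(j : ℝ)| * |α j|) :
    ∃ Ap Bp Am Bm : ℤ → ℂ,
      (∀ j : ℤ,
        Ap j + Bp j * (j : ℂ) = Ap (j - 1) + Bp (j - 1) * (j : ℂ) ∧
        Bp j - Bp (j - 1) = (α j : ℂ) * (Ap j + Bp j * (j : ℂ))) ∧
      (∀ j : ℤ,
        Am j + Bm j * (j : ℂ) = Am (j - 1) + Bm (j - 1) * (j : ℂ) ∧
        Bm j - Bm (j - 1) = (α j : ℂ) * (Am j + Bm j * (j : ℂ))) ∧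
      Tendsto Ap atTop (nhds 1) ∧ Tendsto Bp atTop (nhds 0) ∧
      Tendsto Am atBot (nhds 1) ∧ Tendsto Bm atBot (nhds 0) := by
  obtain ⟨Ap, Bp, hp, hAp, hBp⟩ := exists_jost_atTop α hα
  have hα' : Summable fun j : ℤ => |(j : ℝ)| * |α (-j)| := by
    simpa [Function.comp_def] using hα.comp_injective (neg_injective (G := ℤ))
  obtain ⟨A, B, hr, hA, hB⟩ := exists_jost_atTop (fun j => α (-j)) hα'
  have hrefl : Tendsto (fun j : ℤ => -j - 1) atBot atTop :=
    tendsto_atTop_add_const_right _ (-1) tendsto_neg_atBot_atTop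
  refine ⟨Ap, Bp, fun j => A (-j - 1), fun j => -B (-j - 1), hp, fun j => ?_, hAp, hBp,
    hA.comp hrefl, by simpa using (hB.comp hrefl).neg⟩
  obtain ⟨h1, h2⟩ := hr (-j)
  simp only [neg_neg, Int.cast_neg] at h1 h2
  beta_reduce
  rw [show -(j - 1) - 1 = -j by ring]
  constructor
  · linear_combination -h1
  · linear_combination h2 + (α j : ℂ) * h1
end

section
/- Assume α ∈ ℓ^{1,1}(ℤ) and let λ ∈ ℝ∖{0}. Then the series a_+(λ) := (1/(2iλ)) Σ_{j∈ℤ} α_j e^{2iλj} m_+(λ, j) and b(λ) := 1 − (1/(2iλ)) Σ_{j∈ℤ} α_j m_+(λ, j) converge absolutely, and m_+(λ, x) − a_+(λ) e^{−2iλx} − b(λ) → 0 as x → −∞. -/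
open Complex Filter

/-- The summand of the series defining `m_+(λ,x)`, indexed by an increasing tuple
`j : Fin (n+1) → ℤ` (with the convention `j₀ = x`):
`∏_{l} α_{j_l} (e^{2iλ(j_l − j_{l−1})} − 1)/(2iλ)`. -/
noncomputable def jostTermP (α : ℤ → ℝ) (lam : ℂ) (x : ℝ) {n : ℕ} (j : Fin (n + 1) → ℤ) : ℂ :=
  ∏ l : Fin (n + 1),
    (α (j l) : ℂ) *
      ((Complex.exp (2 * Complex.I * lam *
          ((j l : ℂ) - (Fin.cons (x : ℂ) (fun k : Fin n => ((j k.castSucc : ℤ) : ℂ)) : Fin (n + 1) → ℂ) l)) - 1) /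
        (2 * Complex.I * lam))

/-- The index set for `m_+(λ,x)`: strictly increasing integer tuples above `x`. -/
def jostIdxP (x : ℝ) (n : ℕ) : Type :=
  {j : Fin (n + 1) → ℤ // StrictMono j ∧ x < ((j 0 : ℤ) : ℝ)}

/-- `m_+(λ, x) = 1 + Σ_{n≥1} Σ_{x<j₁<⋯<j_n} ∏_l α_{j_l} (e^{2iλ(j_l−j_{l−1})}−1)/(2iλ)`. -/
noncomputable def mPlus (α : ℤ → ℝ) (lam : ℂ) (x : ℝ) : ℂ :=
  1 + ∑' (n : ℕ) (j : jostIdxP x n), jostTermP α lam x j.1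

/-- The kernel `(e^{2iλz} − 1)/(2iλ)`. -/
noncomputable def jostKernel (lam z : ℂ) : ℂ :=
  (Complex.exp (2 * Complex.I * lam * z) - 1) / (2 * Complex.I * lam)

lemma norm_jostKernel_le (lam t : ℝ) : ‖jostKernel lam t‖ ≤ |lam|⁻¹ := by
  have h1 : ‖Complex.exp (2 * Complex.I * lam * t)‖ = 1 := by
    rw [← Complex.norm_exp_ofReal_mul_I (2 * lam * t)]
    congr 2
    push_cast
    ring
  have h2 : ‖Complex.exp (2 * Complex.I * lam * t) - 1‖ ≤ 2 := by
    refine (norm_sub_le _ _).trans ?_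
    rw [h1, norm_one]
    norm_num
  rw [jostKernel, norm_div, norm_mul, norm_mul, Complex.norm_I, Complex.norm_real,
    Real.norm_eq_abs, Complex.norm_ofNat, mul_one, inv_eq_one_div]
  calc _ ≤ 2 / (2 * |lam|) := by gcongr
    _ = 1 / |lam| := by rw [div_mul_eq_div_div]; norm_num

lemma norm_mul_jostKernel_le (α : ℤ → ℝ) (lam x : ℝ) (i : ℤ) :
    ‖(α i : ℂ) * jostKernel lam ((i : ℂ) - x)‖ ≤ |α i| * |lam|⁻¹ := by
  rw [norm_mul, Complex.norm_real, Real.norm_eq_abs]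
  gcongr
  simpa using norm_jostKernel_le lam ((i : ℝ) - x)

lemma norm_jostTermP_le (α : ℤ → ℝ) (lam x : ℝ) {n : ℕ} (j : Fin (n + 1) → ℤ) :
    ‖jostTermP α lam x j‖ ≤ ∏ l, |α (j l)| * |lam|⁻¹ := by
  rw [jostTermP, norm_prod]
  refine Finset.prod_le_prod (fun _ _ => norm_nonneg _) fun l _ => ?_
  cases l using Fin.cases with
  | zero => exact norm_mul_jostKernel_le α lam x (j 0)
  | succ k => simpa [jostKernel] using norm_mul_jostKernel_le α lam (j k.castSucc) (j k.succ)

lemma jostTermP_cons (α : ℤ → ℝ) (lam : ℂ) (x : ℝ) {n : ℕ} (i : ℤ) (j : Fin (n + 1) → ℤ) :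
    jostTermP α lam x (Fin.cons i j : Fin (n + 2) → ℤ) =
      α i * jostKernel lam ((i : ℂ) - x) * jostTermP α lam i j := by
  rw [jostTermP, Fin.prod_univ_succ, jostTermP]
  congr 1
  refine Finset.prod_congr rfl fun l _ => ?_
  cases l using Fin.cases <;> simp

/-- Increasing tuples above `x` are a first entry `i > x` followed by an increasing tuple
above `i`. -/
def jostIdxPConsEquiv (x : ℝ) (n : ℕ) :
    (Σ i : {i : ℤ // x < i}, jostIdxP (i.1 : ℝ) n) ≃ jostIdxP x (n + 1) where
  toFun p := ⟨Fin.cons p.1.1 p.2.1, by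
    obtain ⟨⟨i, hi⟩, ⟨j, hj, h0⟩⟩ := p
    refine ⟨Fin.strictMono_iff_lt_succ.2 fun k => ?_, hi⟩
    cases k using Fin.cases with
    | zero => simpa using h0
    | succ k => simpa [← Fin.succ_castSucc] using hj k.castSucc_lt_succ⟩
  invFun j := ⟨⟨j.1 0, j.2.2⟩, ⟨Fin.tail j.1,
    fun _ _ h => j.2.1 (Fin.succ_lt_succ_iff.2 h),
    by exact_mod_cast j.2.1 (Fin.succ_pos 0)⟩⟩
  left_inv _ := rfl
  right_inv j := Subtype.ext (Fin.cons_self_tail j.1)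

/-- Increasing tuples above `x` of length one are integers above `x`. -/
def jostIdxPZeroEquiv (x : ℝ) : {i : ℤ // x < i} ≃ jostIdxP x 0 where
  toFun i := ⟨fun _ => i.1, fun a b h => absurd h (by omega), i.2⟩
  invFun j := ⟨j.1 0, j.2.2⟩
  left_inv _ := rfl
  right_inv j := Subtype.ext (funext fun l => by rw [Fin.fin_one_eq_zero l])

lemma summable_sigma_prod_strictMono {β : ℤ → ℝ} (h0 : ∀ i, 0 ≤ β i) (hβ : Summable β) :
    Summable fun p : Σ n : ℕ, {j : Fin (n + 1) → ℤ // StrictMono j} => ∏ l, β (p.2.1 l) := by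
  let e : (Σ n : ℕ, {j : Fin (n + 1) → ℤ // StrictMono j}) → Finset ℤ :=
    fun p => Finset.univ.map ⟨p.2.1, p.2.2.injective⟩
  have he : Function.Injective e := by
    rintro ⟨n, j, hj⟩ ⟨m, k, hk⟩ h
    have hc : n + 1 = m + 1 := by simpa [e] using congrArg Finset.card h
    obtain rfl : n = m := by omega
    have hr : Set.range j = Set.range k := by
      simpa [e] using congrArg (fun s : Finset ℤ => (s : Set ℤ)) h
    obtain rfl := (hj.range_inj hk).1 hr
    rfl
  refine ((summable_finsetProd_of_summable_nonneg h0 hβ).comp_injective he).congr fun p => ?_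
  simp [e]

/-- The contribution to `m_+(λ,x)` of the tuples of length `n + 1`. -/
noncomputable def jostPart (α : ℤ → ℝ) (lam : ℂ) (x : ℝ) (n : ℕ) : ℂ :=
  ∑' j : jostIdxP x n, jostTermP α lam x j.1

section

variable {α : ℤ → ℝ} {lam : ℝ}

lemma summable_prod_strictMono (hα : Summable fun i => |α i|) (n : ℕ) :
    Summable fun j : {j : Fin (n + 1) → ℤ // StrictMono j} => ∏ l, |α (j.1 l)| * |lam|⁻¹ :=
  (summable_sigma_prod_strictMono (fun _ => by positivity) (hα.mul_right |lam|⁻¹)).sigma_factor n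

lemma jostIdxP.toStrictMono_injective (x : ℝ) (n : ℕ) :
    Function.Injective fun j : jostIdxP x n =>
      (⟨j.1, j.2.1⟩ : {j : Fin (n + 1) → ℤ // StrictMono j}) :=
  fun _ _ h => Subtype.ext (congrArg (fun t : {j : Fin (n + 1) → ℤ // StrictMono j} => t.1) h)

lemma summable_norm_jostTermP (hα : Summable fun i => |α i|) (x : ℝ) (n : ℕ) :
    Summable fun j : jostIdxP x n => ‖jostTermP α lam x j.1‖ := by
  have h := (summable_prod_strictMono (lam := lam) hα n).comp_injective
    (jostIdxP.toStrictMono_injective x n)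
  exact .of_nonneg_of_le (fun _ => norm_nonneg _) (fun j => norm_jostTermP_le α lam x j.1) h

lemma exists_summable_bound_jostPart (hα : Summable fun i => |α i|) :
    ∃ c : ℕ → ℝ, Summable c ∧ ∀ x n, ‖jostPart α lam x n‖ ≤ c n := by
  refine ⟨fun n => ∑' j : {j : Fin (n + 1) → ℤ // StrictMono j}, ∏ l, |α (j.1 l)| * |lam|⁻¹,
    (summable_sigma_prod_strictMono (fun _ => by positivity) (hα.mul_right |lam|⁻¹)).sigma,
    fun x n => ?_⟩
  refine (norm_tsum_le_tsum_norm (summable_norm_jostTermP hα x n)).trans ?_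
  exact Summable.tsum_le_tsum_of_inj _ (jostIdxP.toStrictMono_injective x n)
    (fun _ _ => by positivity) (fun j => norm_jostTermP_le α lam x j.1)
    (summable_norm_jostTermP hα x n) (summable_prod_strictMono hα n)

lemma jostPart_zero (x : ℝ) :
    jostPart α lam x 0 = ∑' i : {i : ℤ // x < i}, (α i : ℂ) * jostKernel lam ((i : ℂ) - x) := by
  rw [jostPart, ← (jostIdxPZeroEquiv x).tsum_eq]
  refine tsum_congr fun i => ?_
  change jostTermP α lam x (fun _ : Fin 1 => i.1) = _
  simp [jostTermP, jostKernel]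

lemma jostPart_succ (hα : Summable fun i => |α i|) (x : ℝ) (n : ℕ) :
    jostPart α lam x (n + 1) = ∑' i : {i : ℤ // x < i},
      (α i : ℂ) * jostKernel lam ((i : ℂ) - x) * jostPart α lam (i : ℤ) n := by
  have hs := (jostIdxPConsEquiv x n).summable_iff.2
    (summable_norm_jostTermP (lam := lam) hα x (n + 1)).of_norm
  rw [jostPart, ← (jostIdxPConsEquiv x n).tsum_eq]
  refine hs.tsum_sigma.trans (tsum_congr fun i => ?_)
  rw [jostPart, ← tsum_mul_left]
  exact tsum_congr fun j => jostTermP_cons α lam x i.1 j.1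

lemma exists_norm_mPlus_le (hα : Summable fun i => |α i|) :
    ∃ C, ∀ x, ‖mPlus α lam x‖ ≤ C := by
  obtain ⟨c, hc, hb⟩ := exists_summable_bound_jostPart (lam := lam) hα
  refine ⟨1 + ∑' n, c n, fun x => (norm_add_le _ _).trans ?_⟩
  rw [norm_one]
  gcongr
  exact tsum_of_norm_bounded hc.hasSum (hb x)

/-- The discrete Volterra equation satisfied by `m_+`. -/
lemma mPlus_eq_one_add_tsum (hα : Summable fun i => |α i|) (x : ℝ) :
    mPlus α lam x = 1 + ∑' i : {i : ℤ // x < i},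
      (α i : ℂ) * jostKernel lam ((i : ℂ) - x) * mPlus α lam (i : ℤ) := by
  obtain ⟨c, hc, hb⟩ := exists_summable_bound_jostPart (lam := lam) hα
  have hsum (y : ℝ) : Summable (jostPart α lam y) := .of_norm_bounded hc (hb y)
  have hβ : Summable fun i : {i : ℤ // x < i} => |α i| * |lam|⁻¹ :=
    (hα.mul_right |lam|⁻¹).subtype {i : ℤ | x < i}
  have hc0 (n : ℕ) : 0 ≤ c n := (norm_nonneg _).trans (hb 0 n)
  have hcβ := hc.mul_of_nonneg hβ hc0 fun _ => by positivity
  have hp : Summable fun p : ℕ × {i : ℤ // x < i} =>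
      (α p.2 : ℂ) * jostKernel lam ((p.2 : ℂ) - x) * jostPart α lam (p.2 : ℤ) p.1 := by
    refine .of_norm_bounded hcβ fun p => ?_
    rw [norm_mul, mul_comm (c p.1)]
    gcongr
    · exact norm_mul_jostKernel_le α lam x p.2
    · exact hb _ _
  have hk : Summable fun i : {i : ℤ // x < i} => (α i : ℂ) * jostKernel lam ((i : ℂ) - x) :=
    .of_norm_bounded hβ fun i => norm_mul_jostKernel_le α lam x i
  have hm (y : ℝ) : mPlus α lam y = 1 + ∑' n, jostPart α lam y n := rfl
  have hcol (i : {i : ℤ // x < i}) :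
      (α i : ℂ) * jostKernel lam ((i : ℂ) - x) * mPlus α lam (i : ℤ) =
        (α i : ℂ) * jostKernel lam ((i : ℂ) - x) +
          ∑' n, (α i : ℂ) * jostKernel lam ((i : ℂ) - x) * jostPart α lam (i : ℤ) n := by
    rw [hm, mul_add, mul_one, tsum_mul_left]
  have hcols : Summable fun i : {i : ℤ // x < i} =>
      ∑' n, (α i : ℂ) * jostKernel lam ((i : ℂ) - x) * jostPart α lam (i : ℤ) n :=
    hp.prod_symm.prod
  have hswap : ∑' n, jostPart α lam x (n + 1) = ∑' i : {i : ℤ // x < i},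
      ∑' n, (α i : ℂ) * jostKernel lam ((i : ℂ) - x) * jostPart α lam (i : ℤ) n :=
    (tsum_congr fun n => jostPart_succ hα x n).trans (Summable.tsum_comm hp.prod_symm)
  rw [tsum_congr hcol, hk.tsum_add hcols, hm, (hsum x).tsum_eq_zero_add, jostPart_zero, hswap]

end

/-- For `α ∈ ℓ^{1,1}(ℤ)` and real `λ ≠ 0`, the series defining
`a_+(λ) = (2iλ)⁻¹ Σ_j α_j e^{2iλj} m_+(λ,j)` and
`b(λ) = 1 − (2iλ)⁻¹ Σ_j α_j m_+(λ,j)` converge absolutely, and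
`m_+(λ,x) − a_+(λ) e^{−2iλx} − b(λ) → 0` as `x → −∞`. -/
theorem statement15 (α : ℤ → ℝ) (hα : Summable fun j : ℤ => |(j : ℝ)| * |α j|)
    (lam : ℝ) (hlam : lam ≠ 0) :
    Summable (fun j : ℤ =>
      (α j : ℂ) * Complex.exp (2 * Complex.I * (lam : ℂ) * (j : ℂ)) * mPlus α (lam : ℂ) (j : ℝ)) ∧
    Summable (fun j : ℤ => (α j : ℂ) * mPlus α (lam : ℂ) (j : ℝ)) ∧
    Tendsto (fun x : ℝ =>
        mPlus α (lam : ℂ) x -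
          ((1 / (2 * Complex.I * (lam : ℂ))) *
              ∑' j : ℤ, (α j : ℂ) * Complex.exp (2 * Complex.I * (lam : ℂ) * (j : ℂ)) *
                mPlus α (lam : ℂ) (j : ℝ)) *
            Complex.exp (-(2 * Complex.I * (lam : ℂ) * (x : ℂ))) -
          (1 - (1 / (2 * Complex.I * (lam : ℂ))) *
              ∑' j : ℤ, (α j : ℂ) * mPlus α (lam : ℂ) (j : ℝ)))
      atBot (nhds 0) := by
  have hα1 : Summable fun i => |α i| := by
    refine Summable.of_norm_bounded_eventually hα ?_
    filter_upwards [(Set.finite_singleton (0 : ℤ)).compl_mem_cofinite] with i hi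
    have h1 : (1 : ℝ) ≤ |(i : ℝ)| := by exact_mod_cast Int.one_le_abs hi
    simpa using le_mul_of_one_le_left (abs_nonneg (α i)) h1
  obtain ⟨C, hC⟩ := exists_norm_mPlus_le (lam := lam) hα1
  have hC0 : 0 ≤ C := (norm_nonneg _).trans (hC 0)
  have hexp (t : ℝ) : ‖Complex.exp (2 * Complex.I * lam * t)‖ = 1 := by
    rw [← Complex.norm_exp_ofReal_mul_I (2 * lam * t)]
    congr 2
    push_cast
    ring
  have hb : Summable fun j : ℤ => (α j : ℂ) * mPlus α lam (j : ℝ) := by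
    refine .of_norm_bounded (hα1.mul_right C) fun j => ?_
    rw [norm_mul, Complex.norm_real, Real.norm_eq_abs]
    gcongr
    exact hC _
  have ha : Summable fun j : ℤ =>
      (α j : ℂ) * Complex.exp (2 * Complex.I * lam * j) * mPlus α lam (j : ℝ) := by
    refine .of_norm_bounded hb.norm fun j => ?_
    have := hexp j
    push_cast at this
    rw [norm_mul, norm_mul, this, mul_one, norm_mul]
  refine ⟨ha, hb, ?_⟩
  have hlim : Tendsto (fun x : ℝ => ∑' j : ℤ, {j : ℤ | (j : ℝ) ≤ x}.indicator
      (fun j => -((α j : ℂ) * jostKernel lam ((j : ℂ) - x) * mPlus α lam (j : ℝ))) j)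
      atBot (nhds (∑' _ : ℤ, 0)) := by
    refine tendsto_tsum_of_dominated_convergence ((hα1.mul_right |lam|⁻¹).mul_right C)
      (fun j => ?_) (.of_forall fun x j => (norm_indicator_le_norm_self _ _).trans ?_)
    · refine tendsto_const_nhds.congr' ?_
      filter_upwards [eventually_lt_atBot (j : ℝ)] with x hx
      rw [Set.indicator_of_notMem]
      simpa using hx
    · rw [norm_neg, norm_mul]
      gcongr
      · exact norm_mul_jostKernel_le α lam x j
      · exact hC _
  rw [tsum_zero] at hlim
  refine hlim.congr fun x => ?_
  have hF (j : ℤ) : (α j : ℂ) * jostKernel lam ((j : ℂ) - x) * mPlus α lam (j : ℝ) =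
      1 / (2 * Complex.I * lam) * Complex.exp (-(2 * Complex.I * lam * x)) *
        ((α j : ℂ) * Complex.exp (2 * Complex.I * lam * j) * mPlus α lam (j : ℝ)) -
      1 / (2 * Complex.I * lam) * ((α j : ℂ) * mPlus α lam (j : ℝ)) := by
    rw [jostKernel, mul_sub, Complex.exp_sub, Complex.exp_neg]
    ring
  have hFs : Summable fun j : ℤ =>
      (α j : ℂ) * jostKernel lam ((j : ℂ) - x) * mPlus α lam (j : ℝ) := by
    simp_rw [hF]
    exact (ha.mul_left _).sub (hb.mul_left _)
  have hFt : ∑' j : ℤ, (α j : ℂ) * jostKernel lam ((j : ℂ) - x) * mPlus α lam (j : ℝ) =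
      1 / (2 * Complex.I * lam) * Complex.exp (-(2 * Complex.I * lam * x)) *
        (∑' j : ℤ, (α j : ℂ) * Complex.exp (2 * Complex.I * lam * j) * mPlus α lam (j : ℝ)) -
      1 / (2 * Complex.I * lam) * ∑' j : ℤ, (α j : ℂ) * mPlus α lam (j : ℝ) := by
    simp_rw [hF]
    rw [(ha.mul_left _).tsum_sub (hb.mul_left _), tsum_mul_left, tsum_mul_left]
  have hsplit := hFs.tsum_subtype_add_tsum_subtype_compl {j : ℤ | (j : ℝ) ≤ x}
  have hcompl : {j : ℤ | (j : ℝ) ≤ x}ᶜ = {j : ℤ | x < j} := by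
    ext j
    simp
  rw [hcompl, hFt] at hsplit
  have hm := mPlus_eq_one_add_tsum (lam := lam) hα1 x
  rw [← tsum_subtype, tsum_neg]
  change _ = 1 + ∑' i : {j : ℤ | x < j}, _ at hm
  linear_combination -hsplit - hm
end
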